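/- Let (C,D) be a regular inclusion and, for j = 1, 2, let (C_j, D_j, α_j) be Cartan envelopes of (C,D), with E_j : C_j → D_j the faithful conditional expectations of the Cartan inclusions (C_j,D_j). Then there exists a unique regular *-isomorphism ψ : C₁ → C₂ with ψ ∘ α₁ = α₂; moreover ψ satisfies ψ(α₁(v)·E₁(α₁(x))) = α₂(v)·E₂(α₂(x)) for every v ∈ N(C,D) and every x ∈ C. -/

import Mathlib

open scoped ComplexOrder
open WeakDual
set_option linter.unusedSectionVars false

namespace RegularInclusion

variable {A : Type*} [NormedRing A] [StarRing A] [CStarRing A] [CompleteSpace A]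
  [NormedAlgebra ℂ A] [StarModule ℂ A]

/-- The set of normalizers of the subalgebra `D` in `A`:
`N(A,D) = {v | v* D v ⊆ D and v D v* ⊆ D}`. -/
def normSet (D : StarSubalgebra ℂ A) : Set A :=
  {v | (∀ d ∈ D, star v * d * v ∈ D) ∧ (∀ d ∈ D, v * d * star v ∈ D)}

lemma normSet.star_mul_self_mem {D : StarSubalgebra ℂ A} {v : A} (hv : v ∈ normSet D) :
    star v * v ∈ D := by simpa using hv.1 1 D.one_mem

lemma normSet.mul_star_self_mem {D : StarSubalgebra ℂ A} {v : A} (hv : v ∈ normSet D) :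
    v * star v ∈ D := by simpa using hv.2 1 D.one_mem

/-- `D` is abelian. -/
def IsAbelian (D : StarSubalgebra ℂ A) : Prop := ∀ x ∈ D, ∀ y ∈ D, x * y = y * x

/-- `(A, D)` is an inclusion: `D` is an abelian closed unital `C*`-subalgebra of `A`. -/
def IsInclusion (D : StarSubalgebra ℂ A) : Prop := IsAbelian D ∧ IsClosed (D : Set A)

/-- `(A, D)` is a regular inclusion: an inclusion for which the closed linear span of the
normalizers is all of `A`. -/
def IsRegularIncl (D : StarSubalgebra ℂ A) : Prop :=
  IsInclusion D ∧ closure (Submodule.span ℂ (normSet D) : Set A) = Set.univ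

/-- `D` is a MASA in `A`: `D` is abelian and contains every element commuting with it. -/
def IsMasa (D : StarSubalgebra ℂ A) : Prop :=
  IsAbelian D ∧ ∀ x : A, (∀ d ∈ D, x * d = d * x) → x ∈ D

/-- The relative commutant `D^c` of `D` in `A`. -/
def relComm (D : StarSubalgebra ℂ A) : StarSubalgebra ℂ A :=
  { Subalgebra.centralizer ℂ (D : Set A) with
    star_mem' := by
      intro x hx d hd
      have h := congrArg star (hx (star d) (star_mem hd))
      simpa [star_mul] using h.symm }

lemma mem_relComm {D : StarSubalgebra ℂ A} {x : A} :
    x ∈ relComm D ↔ ∀ d ∈ D, d * x = x * d := Iff.rfl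

/-- `E : A → A` is a conditional expectation onto `D`. -/
structure IsCondExp [PartialOrder A] [StarOrderedRing A] (D : StarSubalgebra ℂ A)
    (E : A →ₗ[ℂ] A) : Prop where
  mem : ∀ x : A, E x ∈ D
  idOn : ∀ d ∈ D, E d = d
  pos : ∀ x : A, 0 ≤ x → 0 ≤ E x
  bimod : ∀ d ∈ D, ∀ d' ∈ D, ∀ x : A, E (d * x * d') = d * E x * d'

/-- A linear map is faithful if `E (x* x) = 0` implies `x = 0`. -/
def Faithful (E : A →ₗ[ℂ] A) : Prop := ∀ x : A, E (star x * x) = 0 → x = 0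

/-- `(A,D)` is a Cartan inclusion: a regular MASA inclusion admitting a faithful conditional
expectation onto `D`. -/
def IsCartanIncl [PartialOrder A] [StarOrderedRing A] (D : StarSubalgebra ℂ A) : Prop :=
  IsRegularIncl D ∧ IsMasa D ∧ ∃ E : A →ₗ[ℂ] A, IsCondExp D E ∧ Faithful E

/-- The fixed-point set of the partial homeomorphism `β_v` of the character space of `D`:
those characters `σ` with `σ(v*v) > 0` and `σ(v* h v) = σ(h)·σ(v*v)` for all `h ∈ D`. -/
def fixBeta (D : StarSubalgebra ℂ A) {v : A} (hv : v ∈ normSet D) :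
    Set (characterSpace ℂ ↥D) :=
  {σ | 0 < σ (⟨star v * v, normSet.star_mul_self_mem hv⟩ : D) ∧
    ∀ h : D, σ (⟨star v * (h : A) * v, hv.1 (h : A) h.2⟩ : D)
      = σ h * σ (⟨star v * v, normSet.star_mul_self_mem hv⟩ : D)}

/-- A subset `S` of a topological algebra `B` is essential in `B` if the only closed two-sided
ideal of `B` meeting `S` trivially is the zero ideal. -/
def EssentialInSet (B : Type*) [NonUnitalNonAssocRing B] [TopologicalSpace B]
    (S : Set B) : Prop :=
  ∀ J : TwoSidedIdeal B, IsClosed (J : Set B) → (J : Set B) ∩ S = {0} → J = ⊥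

section Two
variable {B : Type*} [NormedRing B] [StarRing B] [CStarRing B] [CompleteSpace B]
  [NormedAlgebra ℂ B] [StarModule ℂ B]

/-- A `*`-homomorphism between inclusions is regular if it maps `D` into `D₁` and
normalizers to normalizers. -/
def IsRegularHom (D : StarSubalgebra ℂ A) (D₁ : StarSubalgebra ℂ B) (α : A →⋆ₐ[ℂ] B) : Prop :=
  (∀ d ∈ D, α d ∈ D₁) ∧ (∀ v ∈ normSet D, α v ∈ normSet D₁)

/-- `(B, D₁, α)` is a package for the regular inclusion `(A, D)`, witnessed by the faithful
conditional expectation `E₁`: `(B,D₁)` is a regular inclusion, `α` is an injective regular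
`*`-homomorphism, `B` is generated as a `C*`-algebra by `α(A) ∪ E₁(α(A))` and `D₁` is
generated by `E₁(α(A))`. -/
def IsPackage [PartialOrder B] [StarOrderedRing B] (D : StarSubalgebra ℂ A)
    (D₁ : StarSubalgebra ℂ B) (α : A →⋆ₐ[ℂ] B) (E₁ : B →ₗ[ℂ] B) : Prop :=
  IsRegularIncl D₁ ∧ Function.Injective α ∧ IsRegularHom D D₁ α ∧
    IsCondExp D₁ E₁ ∧ Faithful E₁ ∧
    (StarAlgebra.adjoin ℂ (Set.range ⇑α ∪ ⇑E₁ '' Set.range ⇑α)).topologicalClosure = ⊤ ∧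
    (StarAlgebra.adjoin ℂ (⇑E₁ '' Set.range ⇑α)).topologicalClosure = D₁

/-- `(D₁, α|_D)` is an essential extension of `D`. -/
def EssentialExtIn (D : StarSubalgebra ℂ A) (D₁ : StarSubalgebra ℂ B) (α : A →⋆ₐ[ℂ] B) : Prop :=
  EssentialInSet ↥D₁ {x : ↥D₁ | ∃ d ∈ D, α d = (x : B)}

/-- `(B, D₁, α)` is a Cartan envelope of `(A, D)`, witnessed by the faithful conditional
expectation `E₁`: a package for which `(B,D₁)` is moreover a Cartan inclusion (i.e. `D₁` is
a MASA in `B`) and `(D₁, α|_D)` is an essential extension of `D`. -/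
def IsCartanEnvelope [PartialOrder B] [StarOrderedRing B] (D : StarSubalgebra ℂ A)
    (D₁ : StarSubalgebra ℂ B) (α : A →⋆ₐ[ℂ] B) (E₁ : B →ₗ[ℂ] B) : Prop :=
  IsPackage D D₁ α E₁ ∧ IsMasa D₁ ∧ EssentialExtIn D D₁ α

end Two

/-- The set of normalizers of `Dα` relative to the subalgebra `Cα`. -/
def normSetRel (Cα Dα : StarSubalgebra ℂ A) : Set A :=
  {v | v ∈ Cα ∧ (∀ d ∈ Dα, star v * d * v ∈ Dα) ∧ (∀ d ∈ Dα, v * d * star v ∈ Dα)}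

/-- `φ` is an eigenfunctional for `(A,D)` with range character `r` and source character `s`. -/
def IsEigen (D : StarSubalgebra ℂ A) (φ : A →L[ℂ] ℂ) (r s : ↥D →ₐ[ℂ] ℂ) : Prop :=
  φ ≠ 0 ∧ ∀ (d₁ d₂ : D) (x : A), φ ((d₁ : A) * x * (d₂ : A)) = r d₁ * φ x * s d₂

/-- `f` is a state on `A`. -/
def IsState (f : A →ₗ[ℂ] ℂ) : Prop := f 1 = 1 ∧ ∀ x : A, 0 ≤ f (star x * x)

/-- `f ∈ Mod(A,D)`: a state whose restriction to `D` is multiplicative (hence a character). -/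
def InMod (D : StarSubalgebra ℂ A) (f : A →ₗ[ℂ] ℂ) : Prop :=
  IsState f ∧ ∀ d₁ d₂ : D, f ((d₁ : A) * (d₂ : A)) = f (d₁ : A) * f (d₂ : A)

/-- `f` is a compatible state: a state with `|f(v)|² ∈ {0, f(v*v)}` for every normalizer `v`. -/
def IsCompatState (D : StarSubalgebra ℂ A) (f : A →ₗ[ℂ] ℂ) : Prop :=
  IsState f ∧ ∀ v ∈ normSet D, f v = 0 ∨ (Complex.normSq (f v) : ℂ) = f (star v * v)

/-- `φ` is a compatible eigenfunctional: `|φ(v)|² ∈ {0, s(φ)(v*v)}` for every normalizer `v`. -/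
def IsCompatEigen (D : StarSubalgebra ℂ A) (φ : A →L[ℂ] ℂ) (r s : ↥D →ₐ[ℂ] ℂ) : Prop :=
  IsEigen D φ r s ∧ ∀ v, ∀ hv : v ∈ normSet D,
    φ v = 0 ∨ (Complex.normSq (φ v) : ℂ)
      = s (⟨star v * v, normSet.star_mul_self_mem hv⟩ : D)

/-- The eigenfunctional `[v,f] : x ↦ f(v* x) / f(v* v)^{1/2}`. -/
noncomputable def evf (f : A →ₗ[ℂ] ℂ) (v : A) (x : A) : ℂ :=
  f (star v * x) / (Real.sqrt (f (star v * v)).re : ℂ)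

/-- A bundled unital `C*`-algebra (with its canonical partial order). -/
structure CSA where
  carrier : Type
  [nr : NormedRing carrier]
  [sr : StarRing carrier]
  [cs : CStarRing carrier]
  [cp : CompleteSpace carrier]
  [na : NormedAlgebra ℂ carrier]
  [sm : StarModule ℂ carrier]
  [po : PartialOrder carrier]
  [sor : StarOrderedRing carrier]

attribute [instance] CSA.nr CSA.sr CSA.cs CSA.cp CSA.na CSA.sm CSA.po CSA.sor

end RegularInclusion

namespace RegularInclusion

variable {A : Type*} [NormedRing A] [StarRing A] [CStarRing A] [CompleteSpace A]
  [NormedAlgebra ℂ A] [StarModule ℂ A]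
variable {B : Type*} [NormedRing B] [StarRing B] [CStarRing B] [CompleteSpace B]
  [NormedAlgebra ℂ B] [StarModule ℂ B]

section Commutative

variable {R : Type*} [CommCStarAlgebra R]

lemma norm_le_of_forall_character {x : R} {c : ℝ} (hc : 0 ≤ c)
    (h : ∀ χ : R →ₐ[ℂ] ℂ, ‖χ x‖ ≤ c) : ‖x‖ ≤ c := by
  rw [← (gelfandTransform_isometry R).norm_map_of_map_zero (map_zero _) x]
  exact (ContinuousMap.norm_le _ hc).2 fun χ => h (CharacterSpace.equivAlgHom χ)

lemma eq_zero_of_forall_character {x : R} (h : ∀ χ : R →ₐ[ℂ] ℂ, χ x = 0) : x = 0 :=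
  norm_le_zero_iff.1 (norm_le_of_forall_character le_rfl fun χ => by simp [h χ])

lemma norm_character_le (χ : R →ₐ[ℂ] ℂ) (x : R) : ‖χ x‖ ≤ ‖x‖ := by
  rw [← (gelfandTransform_isometry R).norm_map_of_map_zero (map_zero _) x]
  exact ContinuousMap.norm_coe_le_norm (gelfandTransform ℂ R x) (CharacterSpace.equivAlgHom.symm χ)

/-- Urysohn-type lemma: a basic open set of characters supports a nonzero element. -/
lemma exists_ne_zero_supported (k l : R) {a b : ℝ} (χ₀ : R →ₐ[ℂ] ℂ) (hk : a < ‖χ₀ k‖)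
    (hl : ‖χ₀ l‖ < b) :
    ∃ x : R, x ≠ 0 ∧ ∀ χ : R →ₐ[ℂ] ℂ, χ x ≠ 0 → a < ‖χ k‖ ∧ ‖χ l‖ < b := by
  let F : C(characterSpace ℂ R, ℂ) :=
    ⟨fun χ => ((max (‖gelfandTransform ℂ R k χ‖ - a) 0 *
      max (b - ‖gelfandTransform ℂ R l χ‖) 0 : ℝ) : ℂ), by fun_prop⟩
  have key : ∀ χ : R →ₐ[ℂ] ℂ, χ ((gelfandStarTransform R).symm F) =
      ((max (‖χ k‖ - a) 0 * max (b - ‖χ l‖) 0 : ℝ) : ℂ) := by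
    intro χ
    have h : gelfandStarTransform R ((gelfandStarTransform R).symm F) = F :=
      StarAlgEquiv.apply_symm_apply _ _
    exact congrArg (fun G : C(characterSpace ℂ R, ℂ) => G (CharacterSpace.equivAlgHom.symm χ)) h
  refine ⟨(gelfandStarTransform R).symm F, fun h => ?_, fun χ hχ => ?_⟩
  · have h1 := key χ₀
    rw [h, map_zero, max_eq_left (by linarith), max_eq_left (by linarith)] at h1
    have : (‖χ₀ k‖ - a) * (b - ‖χ₀ l‖) = 0 := by exact_mod_cast h1.symm
    rcases mul_eq_zero.1 this with h | h <;> linarith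
  · rw [key χ] at hχ
    by_contra hcon
    apply hχ
    rw [not_and_or, not_lt, not_lt] at hcon
    rcases hcon with h | h
    · rw [max_eq_right (by linarith)]; simp
    · rw [max_eq_right (a := b - _) (by linarith)]; simp

lemma EssentialInSet.exists_supported {S : Set R} (hS : EssentialInSet R S) (h0 : (0 : R) ∈ S)
    (k l : R) {a b : ℝ} (χ₀ : R →ₐ[ℂ] ℂ) (hk : a < ‖χ₀ k‖) (hl : ‖χ₀ l‖ < b) :
    ∃ x ∈ S, x ≠ 0 ∧ ∀ χ : R →ₐ[ℂ] ℂ, χ x ≠ 0 → a < ‖χ k‖ ∧ ‖χ l‖ < b := by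
  let K : Set R := {x | ∀ χ : R →ₐ[ℂ] ℂ, ¬(a < ‖χ k‖ ∧ ‖χ l‖ < b) → χ x = 0}
  let J : TwoSidedIdeal R := TwoSidedIdeal.mk' K (fun χ _ => map_zero χ)
    (fun hx hy χ h => by rw [map_add, hx χ h, hy χ h, add_zero])
    (fun hx χ h => by rw [map_neg, hx χ h, neg_zero])
    (fun hx χ h => by rw [map_mul, hx χ h, mul_zero])
    (fun hx χ h => by rw [map_mul, hx χ h, zero_mul])
  have hJ : (J : Set R) = K := TwoSidedIdeal.coe_mk' ..
  have hclosed : IsClosed K := by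
    have : K = ⋂ χ : R →ₐ[ℂ] ℂ, ⋂ _ : ¬(a < ‖χ k‖ ∧ ‖χ l‖ < b), {x | χ x = 0} := by
      ext; simp [K]
    rw [this]
    refine isClosed_iInter fun χ => isClosed_iInter fun _ => ?_
    have hc : Continuous χ := by
      refine AddMonoidHomClass.continuous_of_bound χ 1 fun x => ?_
      simpa using norm_character_le χ x
    exact isClosed_eq hc continuous_const
  by_contra! hcon
  have hbot := hS J (hJ ▸ hclosed) (by
    rw [hJ]
    ext x
    refine ⟨fun ⟨hx, hxS⟩ => ?_, fun hx => ?_⟩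
    · by_contra hx0
      obtain ⟨χ, h1, h2⟩ := hcon x hxS hx0
      exact h1 (hx χ fun h => (h2 h.1).not_gt h.2)
    · rw [Set.mem_singleton_iff.1 hx]
      exact ⟨fun χ _ => map_zero χ, h0⟩)
  obtain ⟨x, hx0, hx⟩ := exists_ne_zero_supported k l χ₀ hk hl
  have hxJ : x ∈ (J : Set R) := by
    rw [hJ]
    exact fun χ h => by_contra fun h' => h (hx χ h')
  rw [hbot] at hxJ
  exact hx0 (by simpa using hxJ)

/-- A map of the form `h ↦ w* h w` acting on an essential subset as multiplication by `p` is
multiplication by `p`. -/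
lemma EssentialInSet.apply_eq_mul {S : Set R} (hS : EssentialInSet R S) (h0 : (0 : R) ∈ S)
    {p : R} {Φ : R →ₗ[ℂ] R} (hone : Φ 1 = p) (hmul : ∀ x y, Φ x * Φ y = p * Φ (x * y))
    (hΦ : ∀ s ∈ S, Φ s = p * s) (h : R) : Φ h = p * h := by
  rw [← sub_eq_zero]
  refine eq_zero_of_forall_character fun χ₀ => by_contra fun hne => ?_
  set h' : R := h - χ₀ h • (1 : R) with hh'
  have hl : χ₀ h' = 0 := by simp [hh']
  have hk : χ₀ (Φ h') ≠ 0 := by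
    have : χ₀ (Φ h') = χ₀ (Φ h - p * h) := by
      simp [hh', map_sub, map_smul, hone, mul_comm]
    rwa [this]
  have hc : 0 < ‖χ₀ (Φ h')‖ := norm_pos_iff.2 hk
  set c := ‖χ₀ (Φ h')‖
  have hM : 0 < ‖p‖ + 1 := by positivity
  obtain ⟨s, hsS, hs0, hs⟩ := hS.exists_supported h0 (Φ h') h' (a := c / 2)
    (b := c / 2 / (‖p‖ + 1)) χ₀ (by linarith [half_lt_self hc]) (by rw [hl, norm_zero]; positivity)
  obtain ⟨ψ, hψ⟩ : ∃ ψ : R →ₐ[ℂ] ℂ, ψ s ≠ 0 := by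
    by_contra! hcon
    exact hs0 (eq_zero_of_forall_character hcon)
  have hψk := (hs ψ hψ).1
  have hψp : ψ p ≠ 0 := by
    intro hp
    have : ψ (Φ h') * ψ (Φ h') = 0 := by rw [← map_mul, hmul, map_mul, hp, zero_mul]
    rw [mul_self_eq_zero.1 this, norm_zero] at hψk
    linarith
  let ψ' : R →ₐ[ℂ] ℂ := AlgHom.ofLinearMap ((ψ p)⁻¹ • (ψ.toLinearMap ∘ₗ Φ))
    (by simp [hone, hψp]) (fun x y => by
      have := congrArg ψ (hmul x y)
      simp only [map_mul] at this
      simp only [LinearMap.smul_apply, LinearMap.comp_apply, AlgHom.toLinearMap_apply, smul_eq_mul]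
      field_simp
      linear_combination -this)
  have hψ' : ∀ x, ψ (Φ x) = ψ p * ψ' x := fun x => by
    change _ = ψ p * ((ψ p)⁻¹ * ψ (Φ x))
    field_simp
  have hs' : ψ' s ≠ 0 := by
    have := hψ' s
    rw [hΦ s hsS, map_mul] at this
    rwa [← mul_left_cancel₀ hψp this]
  have hlt := (hs ψ' hs').2
  rw [lt_div_iff₀ hM] at hlt
  rw [hψ' h', norm_mul] at hψk
  nlinarith [norm_character_le ψ p, norm_nonneg (ψ' h')]

end Commutative

/-- An inclusion makes `D` a commutative `C*`-algebra. -/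
noncomputable abbrev IsInclusion.commCStarAlgebra {D : StarSubalgebra ℂ A} (h : IsInclusion D) :
    CommCStarAlgebra D :=
  letI : CStarAlgebra A := {}
  haveI : IsClosed (D : Set A) := h.2
  { StarSubalgebra.cstarAlgebra D with
    mul_comm := fun x y => Subtype.ext (h.1 x x.2 y y.2) }

lemma IsAbelian.star_mul_eq_zero {D : StarSubalgebra ℂ A} (hD : IsAbelian D) {e d : A} (he : e ∈ D)
    (h : e * d = 0) : star e * d = 0 := by
  rw [← CStarRing.star_mul_self_eq_zero_iff, star_mul, star_star]
  calc _ = star d * (e * star e) * d := by simp only [mul_assoc]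
    _ = star d * star e * (e * d) := by
      rw [hD _ he _ (star_mem he)]; simp only [mul_assoc]
    _ = 0 := by rw [h, mul_zero]

lemma norm_map_of_injective {α : A →⋆ₐ[ℂ] B} (hinj : Function.Injective α) (c : A) :
    ‖α c‖ = ‖c‖ :=
  let _ : CStarAlgebra A := {}
  let _ : CStarAlgebra B := {}
  NonUnitalStarAlgHom.norm_map α hinj c

lemma continuous_starAlgHom_of_injective {α : A →⋆ₐ[ℂ] B} (hinj : Function.Injective α) :
    Continuous α :=
  (AddMonoidHomClass.isometry_of_norm α (norm_map_of_injective hinj)).continuous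

lemma IsRegularIncl.induction {D : StarSubalgebra ℂ A} (hreg : IsRegularIncl D) {N : Submodule ℂ A}
    (hN : IsClosed (N : Set A)) (h : ∀ v ∈ normSet D, v ∈ N) (x : A) : x ∈ N :=
  Submodule.topologicalClosure_minimal _ (Submodule.span_le.2 h) hN (hreg.2.ge (Set.mem_univ x))

section OneSided

variable {D : StarSubalgebra ℂ A} {D₁ : StarSubalgebra ℂ B} {α : A →⋆ₐ[ℂ] B}

lemma eq_zero_of_character {D : StarSubalgebra ℂ A} (hD : IsInclusion D) {x : D}
    (h : ∀ χ : D →ₐ[ℂ] ℂ, χ x = 0) : x = 0 :=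
  let _ := hD.commCStarAlgebra
  eq_zero_of_forall_character h

lemma EssentialExtIn.exists_supported (hess : EssentialExtIn D D₁ α) (hD₁ : IsInclusion D₁)
    (hα : ∀ d ∈ D, α d ∈ D₁) (k l : D₁) {a b : ℝ} (χ₀ : D₁ →ₐ[ℂ] ℂ) (hk : a < ‖χ₀ k‖)
    (hl : ‖χ₀ l‖ < b) :
    ∃ d, ∃ hd : d ∈ D, d ≠ 0 ∧
      ∀ χ : D₁ →ₐ[ℂ] ℂ, χ ⟨α d, hα d hd⟩ ≠ 0 → a < ‖χ k‖ ∧ ‖χ l‖ < b := by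
  let _ := hD₁.commCStarAlgebra
  have h : EssentialInSet (↥D₁) {x : ↥D₁ | ∃ d ∈ D, α d = (x : B)} := hess
  obtain ⟨x, ⟨d, hd, hdx⟩, hx0, hx⟩ := EssentialInSet.exists_supported h
    ⟨0, D.zero_mem, by simp⟩ k l χ₀ hk hl
  obtain rfl : x = ⟨α d, hα d hd⟩ := Subtype.ext hdx.symm
  refine ⟨d, hd, ?_, hx⟩
  rintro rfl
  exact hx0 (Subtype.ext (map_zero α))

lemma EssentialExtIn.exists_annihilated (hess : EssentialExtIn D D₁ α) (hD₁ : IsInclusion D₁)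
    (hα : ∀ d ∈ D, α d ∈ D₁) {g : B} (hg : g ∈ D₁) (hg0 : g ≠ 0) :
    ∃ d ∈ D, d ≠ 0 ∧ ∀ y ∈ D₁, y * g = 0 → y * α d = 0 := by
  obtain ⟨χ₀, hχ₀⟩ : ∃ χ : D₁ →ₐ[ℂ] ℂ, χ ⟨g, hg⟩ ≠ 0 := by
    by_contra! hcon
    exact hg0 (congrArg Subtype.val (eq_zero_of_character hD₁ hcon))
  obtain ⟨d, hd, hd0, h⟩ := hess.exists_supported hD₁ hα ⟨g, hg⟩ 0 (a := 0) (b := 1) χ₀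
    (norm_pos_iff.2 hχ₀) (by simp)
  refine ⟨d, hd, hd0, fun y hy hyg => ?_⟩
  have : (⟨y, hy⟩ * ⟨α d, hα d hd⟩ : D₁) = 0 := by
    refine eq_zero_of_character hD₁ fun χ => ?_
    rw [map_mul]
    by_cases hχ : χ ⟨α d, hα d hd⟩ = 0
    · rw [hχ, mul_zero]
    · have h1 : χ ⟨y, hy⟩ * χ ⟨g, hg⟩ = 0 := by
        rw [← map_mul, show (⟨y, hy⟩ * ⟨g, hg⟩ : D₁) = 0 from Subtype.ext hyg, map_zero]
      rcases mul_eq_zero.1 h1 with h2 | h2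
      · rw [h2, zero_mul]
      · have := (h χ hχ).1
        simp [h2] at this
  exact congrArg Subtype.val this

/-- Conjugation `h ↦ v* h v` on `D` by a normalizer `v`. -/
def normSet.conj {D : StarSubalgebra ℂ A} {v : A} (hv : v ∈ normSet D) : D →ₗ[ℂ] D where
  toFun h := ⟨star v * h * v, hv.1 h h.2⟩
  map_add' x y := Subtype.ext (by simp [mul_add, add_mul])
  map_smul' c x := Subtype.ext (by simp)

lemma IsAbelian.star_mul_self_commutator_mul {D : StarSubalgebra ℂ A} (hD : IsAbelian D)
    {v h f : A} (hv : v ∈ normSet D) (hh : h ∈ D) (hfD : f ∈ D)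
    (hf : ∀ x ∈ D, star v * x * v * f = star v * v * x * f) :
    star (v * h - h * v) * (v * h - h * v) * f = 0 := by
  have hp := normSet.star_mul_self_mem hv
  have h1 : star v * v * star h = star h * (star v * v) := hD _ hp _ (star_mem hh)
  have h2 : h * f = f * h := hD _ hh _ hfD
  calc _ = star h * (star v * v) * h * f - star h * (star v * h * v * f)
        - star v * star h * v * (h * f) + star v * (star h * h) * v * f := by
        simp only [star_sub, star_mul]; noncomm_ring
    _ = star h * (star v * v) * h * f - star h * (star v * h * v * f)
        - star v * star h * v * f * h + star v * (star h * h) * v * f := by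
        rw [h2]; noncomm_ring
    _ = star h * (star v * v) * h * f - star h * (star v * v * h * f)
        - star v * v * star h * (f * h) + star v * v * star h * h * f := by
        rw [hf h hh, hf _ (mul_mem (star_mem hh) hh), hf _ (star_mem hh)]; noncomm_ring
    _ = 0 := by rw [← h2, h1]; noncomm_ring

/-- In an essential extension, a normalizer commuting with the image of `D` commutes with `D₁`. -/
lemma EssentialExtIn.commute_of_commute (hess : EssentialExtIn D D₁ α) (hD₁ : IsInclusion D₁)
    {w : B} (hw : w ∈ normSet D₁) (hcomm : ∀ d ∈ D, w * α d = α d * w) {h : B} (hh : h ∈ D₁) :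
    w * h = h * w := by
  let _ := hD₁.commCStarAlgebra
  have he : EssentialInSet (↥D₁) {x : ↥D₁ | ∃ d ∈ D, α d = (x : B)} := hess
  have key : ∀ x ∈ D₁, star w * x * w = star w * w * x := by
    intro x hx
    refine congrArg Subtype.val (EssentialInSet.apply_eq_mul he ⟨0, D.zero_mem, by simp⟩
      (p := ⟨star w * w, (normSet.star_mul_self_mem hw)⟩) (Φ := normSet.conj hw) ?_ ?_ ?_ ⟨x, hx⟩)
    · exact Subtype.ext (by simp [normSet.conj])
    · intro x y
      refine Subtype.ext ?_
      change star w * x * w * (star w * y * w) = star w * w * (star w * (x * y) * w)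
      have := hD₁.1 x x.2 _ (normSet.mul_star_self_mem hw)
      calc _ = star w * (x * (w * star w)) * (y * w) := by simp only [mul_assoc]
        _ = _ := by rw [this]; simp only [mul_assoc]
    · rintro s ⟨d, hd, hds⟩
      refine Subtype.ext ?_
      change star w * s * w = star w * w * s
      rw [← hds, mul_assoc, ← hcomm d hd, mul_assoc]
  have := hD₁.1.star_mul_self_commutator_mul (f := 1) hw hh D₁.one_mem fun x hx => by
    rw [mul_one, mul_one, key x hx]
  rwa [mul_one, CStarRing.star_mul_self_eq_zero_iff, sub_eq_zero] at this

/-- If `e` annihilates every `d` for which `v d` commutes with `D`, then `α e` annihilates the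
conditional expectation of `α v`. -/
lemma EssentialExtIn.condExp_mul_eq_zero [PartialOrder B] [StarOrderedRing B]
    (hess : EssentialExtIn D D₁ α) (hD : IsAbelian D) (hD₁ : IsInclusion D₁)
    (hinj : Function.Injective α) (hα : ∀ d ∈ D, α d ∈ D₁) {E : B →ₗ[ℂ] B}
    (hE : IsCondExp D₁ E) {v : A} (hv : α v ∈ normSet D₁) {e : A} (he : e ∈ D)
    (h : ∀ d ∈ D, (∀ k ∈ D, v * d * k = k * (v * d)) → e * d = 0) :
    E (α v) * α e = 0 := by
  by_contra hg0
  have hf := hE.mem (α v)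
  obtain ⟨d, hd, hd0, hann⟩ := hess.exists_annihilated hD₁ hα (mul_mem hf (hα e he)) hg0
  have hp := normSet.star_mul_self_mem hv
  have hq := normSet.mul_star_self_mem hv
  have hfx : ∀ x ∈ D₁, α v * star (α v) * x * E (α v) =
      E (α v) * (star (α v) * x * α v) := by
    intro x hx
    have h1 := hE.bimod _ (mul_mem hq hx) 1 D₁.one_mem (α v)
    have h2 := hE.bimod 1 D₁.one_mem _ (hv.1 x hx) (α v)
    simp only [mul_one, one_mul] at h1 h2
    rw [← h1, ← h2]
    simp only [mul_assoc]
  have hcomm : ∀ x ∈ D₁, star (α v) * x * α v * E (α v) = star (α v) * α v * x * E (α v) := by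
    intro x hx
    have h1 := hfx 1 D₁.one_mem
    simp only [mul_one] at h1
    calc _ = E (α v) * (star (α v) * x * α v) := hD₁.1 _ (hv.1 x hx) _ hf
      _ = x * (α v * star (α v) * E (α v)) := by
        rw [← hfx x hx, hD₁.1 _ hq x hx, mul_assoc]
      _ = x * (star (α v) * α v * E (α v)) := by rw [h1, hD₁.1 _ hf _ hp]
      _ = _ := by rw [← mul_assoc, hD₁.1 _ hx _ hp]
  have hvd : ∀ k ∈ D, v * d * k = k * (v * d) := by
    intro k hk
    set z := v * k - k * v with hz
    have hz1 : star (α z) * α z * E (α v) = 0 := by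
      rw [hz, map_sub, map_mul, map_mul]
      exact hD₁.1.star_mul_self_commutator_mul hv (hα k hk) hf hcomm
    have hzD : star (α z) * α z ∈ D₁ := by
      have h1 : star (α k) ∈ D₁ := star_mem (hα k hk)
      have h2 := hα k hk
      have : star (α z) * α z = star (α k) * (star (α v) * α v) * α k
          - star (α k) * (star (α v) * α k * α v) - star (α v) * star (α k) * α v * α k
          + star (α v) * (star (α k) * α k) * α v := by
        simp only [hz, map_sub, map_mul, star_sub, star_mul]; noncomm_ring
      rw [this]
      exact add_mem (sub_mem (sub_mem (mul_mem (mul_mem h1 hp) h2) (mul_mem h1 (hv.1 _ h2)))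
        (mul_mem (hv.1 _ h1) h2)) (hv.1 _ (mul_mem h1 h2))
    have hz2 := hann _ hzD (by rw [← mul_assoc, hz1, zero_mul])
    have hz3 : z * d = 0 := by
      refine hinj ?_
      rw [map_zero, ← CStarRing.star_mul_self_eq_zero_iff, map_mul, star_mul]
      calc _ = star (α d) * (star (α z) * α z * α d) := by simp only [mul_assoc]
        _ = 0 := by rw [hz2, mul_zero]
    rw [hz, sub_mul, sub_eq_zero] at hz3
    rw [mul_assoc, hD d hd k hk, ← mul_assoc, hz3, mul_assoc]
  have hed := h d hd hvd
  have hed' : star d * e = 0 := hD.star_mul_eq_zero hd ((hD d hd e he).trans hed)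
  have hdd := hann (star (α d)) (star_mem (hα d hd)) (by
    rw [hD₁.1 _ hf _ (hα e he), ← mul_assoc, ← map_star, ← map_mul, hed', map_zero, zero_mul])
  rw [CStarRing.star_mul_self_eq_zero_iff] at hdd
  exact hd0 (hinj (hdd.trans (map_zero α).symm))

/-- Elements which become compatible after multiplication by a large ideal of `D` have
comparable norms. -/
lemma EssentialExtIn.norm_le {B' : Type*} [NormedRing B'] [StarRing B'] [CStarRing B']
    [CompleteSpace B'] [NormedAlgebra ℂ B'] [StarModule ℂ B']
    (hess : EssentialExtIn D D₁ α) (hD : IsAbelian D) (hD₁ : IsInclusion D₁)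
    (hinj : Function.Injective α) (hα : ∀ d ∈ D, α d ∈ D₁) {α' : A →⋆ₐ[ℂ] B'}
    (hinj' : Function.Injective α') {a : B} (ha : a ∈ D₁) {a' : B'}
    (h : ∀ e ∈ D, (∀ d ∈ D, (∃ c, a * α d = α c ∧ a' * α' d = α' c) → e * d = 0) → e = 0) :
    ‖a‖ ≤ ‖a'‖ := by
  have hn : ∀ c : A, ‖α c‖ = ‖c‖ := norm_map_of_injective hinj
  have hn' : ∀ c : A, ‖α' c‖ = ‖c‖ := norm_map_of_injective hinj'
  by_contra! hlt
  obtain ⟨r, hr1, hr2⟩ := exists_between hlt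
  have hr0 : 0 < r := (norm_nonneg _).trans_lt hr1
  let _ := hD₁.commCStarAlgebra
  obtain ⟨χ₀, hχ₀⟩ : ∃ χ : D₁ →ₐ[ℂ] ℂ, r < ‖χ ⟨a, ha⟩‖ := by
    by_contra! hcon
    exact hr2.not_ge (norm_le_of_forall_character hr0.le hcon)
  obtain ⟨d, hd, hd0, hsupp⟩ := hess.exists_supported hD₁ hα ⟨a, ha⟩ 0 (b := 1) χ₀ hχ₀ (by simp)
  refine hd0 (h d hd fun i hi hc => ?_)
  obtain ⟨c, hc, hc'⟩ := hc
  have hle : ‖a * α (d * i)‖ ≤ ‖a'‖ * ‖d * i‖ := by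
    have h1 : a * α (d * i) = α (c * d) := by
      rw [hD d hd i hi, map_mul, ← mul_assoc, hc, map_mul]
    have h2 : a' * α' (d * i) = α' (c * d) := by
      rw [hD d hd i hi, map_mul, ← mul_assoc, hc', map_mul]
    rw [h1, hn, ← hn', ← h2, ← hn' (d * i)]
    exact norm_mul_le _ _
  have hle' : ‖(⟨α (d * i), hα _ (mul_mem hd hi)⟩ : D₁)‖ ≤ ‖a'‖ * ‖d * i‖ / r := by
    refine norm_le_of_forall_character (by positivity) fun χ => ?_
    rw [le_div_iff₀ hr0]
    have hm : χ ⟨α (d * i), hα _ (mul_mem hd hi)⟩ = χ ⟨α d, hα d hd⟩ * χ ⟨α i, hα i hi⟩ := by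
      rw [← map_mul]; exact congrArg χ (Subtype.ext (map_mul α d i))
    by_cases hχ : χ ⟨α d, hα d hd⟩ = 0
    · rw [hm, hχ, zero_mul, norm_zero, zero_mul]; positivity
    · calc _ ≤ ‖χ ⟨α (d * i), hα _ (mul_mem hd hi)⟩‖ * ‖χ ⟨a, ha⟩‖ := by
            gcongr; exact (hsupp χ hχ).1.le
        _ = ‖χ (⟨a, ha⟩ * ⟨α (d * i), hα _ (mul_mem hd hi)⟩)‖ := by
            rw [map_mul χ, norm_mul, mul_comm]
        _ ≤ ‖a * α (d * i)‖ := norm_character_le χ _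
        _ ≤ _ := hle
  have hle'' : ‖d * i‖ ≤ ‖a'‖ * ‖d * i‖ / r :=
    (hn (d * i)).symm.le.trans hle'
  rw [le_div_iff₀ hr0] at hle''
  have : ‖d * i‖ = 0 := by nlinarith [norm_nonneg (d * i)]
  exact norm_eq_zero.1 this

/-- An element of `D₁` annihilated by a large ideal of `D` vanishes. -/
lemma EssentialExtIn.eq_zero_of_mul_eq_zero (hess : EssentialExtIn D D₁ α) (hD₁ : IsInclusion D₁)
    (hinj : Function.Injective α) (hα : ∀ d ∈ D, α d ∈ D₁) {y : B} (hy : y ∈ D₁)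
    (h : ∀ e ∈ D, (∀ d ∈ D, y * α d = 0 → e * d = 0) → e = 0) : y = 0 := by
  by_contra hy0
  obtain ⟨d, hd, hd0, hann⟩ := hess.exists_annihilated hD₁ hα hy hy0
  refine hd0 (h d hd fun i hi hyi => hinj ?_)
  rw [map_mul, map_zero, hD₁.1 _ (hα d hd) _ (hα i hi)]
  exact hann _ (hα i hi) (by rw [hD₁.1 _ (hα i hi) _ hy, hyi])

end OneSided

lemma IsCondExp.continuous [PartialOrder B] [StarOrderedRing B] {D₁ : StarSubalgebra ℂ B}
    {E : B →ₗ[ℂ] B} (hE : IsCondExp D₁ E) : Continuous E := by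
  let _ : CStarAlgebra B := {}
  obtain ⟨C, hC⟩ := PositiveLinearMap.exists_norm_apply_le (PositiveLinearMap.mk₀ E hE.pos)
  exact AddMonoidHomClass.continuous_of_bound E C hC

lemma mul_one_sub_pow_le {y : ℝ} (h0 : 0 ≤ y) (h1 : y ≤ 1) (n : ℕ) : n * (y * (1 - y) ^ n) ≤ 1 := by
  have h2 : 1 + n * y ≤ (1 + y) ^ n := one_add_mul_le_pow (by linarith) n
  have h3 : 0 ≤ (1 - y) ^ n := pow_nonneg (by linarith) n
  calc n * (y * (1 - y) ^ n) ≤ (1 + n * y) * (1 - y) ^ n := by nlinarith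
    _ ≤ (1 + y) ^ n * (1 - y) ^ n := by gcongr
    _ = (1 - y ^ 2) ^ n := by rw [← mul_pow]; ring
    _ ≤ 1 := pow_le_one₀ (by nlinarith) (by nlinarith)

lemma norm_mul_one_sub_pow_sq_le (w : A) (n : ℕ) :
    n * ‖w * (1 - (((‖star w * w‖ + 1)⁻¹ : ℝ) : ℂ) • (star w * w)) ^ n‖ ^ 2 ≤
      ‖star w * w‖ + 1 := by
  let _ : CStarAlgebra A := {}
  set p := star w * w with hp
  set c : ℝ := (‖p‖ + 1)⁻¹ with hc
  have hc0 : 0 < c := by positivity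
  have hpsa : IsSelfAdjoint p := IsSelfAdjoint.star_mul_self w
  set u := 1 - (c : ℂ) • p with hu
  have husa : IsSelfAdjoint u := by
    rw [hu]
    exact (IsSelfAdjoint.one A).sub (IsSelfAdjoint.smul (Complex.conj_ofReal c) hpsa)
  have hcomm : Commute u p := by
    rw [hu]
    exact (Commute.one_left p).sub_left ((Commute.refl p).smul_left _)
  have h1 : star (w * u ^ n) * (w * u ^ n) = p * u ^ (2 * n) := by
    rw [star_mul, star_pow, husa.star_eq, mul_assoc, ← mul_assoc (star w), ← hp, ← mul_assoc,
      (hcomm.pow_left n).eq, mul_assoc, ← pow_add, two_mul]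
  have h2 : p * u ^ (2 * n) = cfc (fun x : ℝ => x * (1 - c * x) ^ (2 * n)) p := by
    have := cfc_map_polynomial (R := ℝ) (p := IsSelfAdjoint)
      (Polynomial.X * (1 - Polynomial.C c * Polynomial.X) ^ (2 * n)) id p hpsa
    simp only [id, Polynomial.eval_mul, Polynomial.eval_X, Polynomial.eval_pow, Polynomial.eval_sub,
      Polynomial.eval_one, Polynomial.eval_C, cfc_id ℝ p, map_mul, Polynomial.aeval_X, map_pow,
      map_sub, map_one, Polynomial.aeval_C] at this
    rw [this, hu, Algebra.algebraMap_eq_smul_one, smul_mul_assoc, one_mul, Complex.coe_smul]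
  rw [sq, ← CStarRing.norm_star_mul_self, h1, h2]
  rcases Nat.eq_zero_or_pos n with rfl | hn
  · simp; positivity
  have hn' : (0 : ℝ) < n := by exact_mod_cast hn
  rw [mul_comm, ← le_div_iff₀ hn']
  refine norm_cfc_le (by positivity) fun x hx => ?_
  have hx0 : 0 ≤ x := spectrum_star_mul_self_nonneg x hx
  have hx1 : x ≤ ‖p‖ := (le_abs_self x).trans (by
    rcases subsingleton_or_nontrivial A with h | h
    · exact (Set.eq_empty_iff_forall_notMem.1 (spectrum.of_subsingleton p) x hx).elim
    · exact spectrum.norm_le_norm_of_mem hx)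
  have hy1 : c * x ≤ 1 := by
    rw [hc, inv_mul_le_iff₀ (by positivity)]; linarith
  have hy0 : 0 ≤ c * x := by positivity
  have hb := mul_one_sub_pow_le hy0 hy1 (2 * n)
  push_cast at hb
  have hpow : 0 ≤ (1 - c * x) ^ (2 * n) := pow_nonneg (by linarith) _
  rw [Real.norm_of_nonneg (by positivity), le_div_iff₀ hn']
  have hxx : x = (‖p‖ + 1) * (c * x) := by rw [hc]; field_simp
  rw [show x * (1 - c * x) ^ (2 * n) * n = (‖p‖ + 1) * (n * (c * x * (1 - c * x) ^ (2 * n))) by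
    nth_rw 1 [hxx]; ring]
  have : n * (c * x * (1 - c * x) ^ (2 * n)) ≤ 1 := by
    have : 0 ≤ n * (c * x * (1 - c * x) ^ (2 * n)) := by positivity
    linarith
  nlinarith [norm_nonneg p]

/-- An element `w` is a limit of elements `w (w* w) d`. -/
lemma mem_closure_mul_star_mul_self {D : StarSubalgebra ℂ A} {w : A} (hw : star w * w ∈ D) :
    w ∈ closure {x | ∃ d ∈ D, x = w * (star w * w) * d} := by
  set p := star w * w with hp
  set c : ℝ := (‖p‖ + 1)⁻¹ with hc
  set u := 1 - (c : ℂ) • p with hu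
  have huD : u ∈ D := sub_mem D.one_mem (SMulMemClass.smul_mem _ hw)
  have hcomm : Commute p u := by
    rw [hu]
    exact (Commute.one_right p).sub_right ((Commute.refl p).smul_right _)
  have hq : ∀ n : ℕ, ∃ q ∈ D, 1 - u ^ n = p * q := by
    intro n
    induction n with
    | zero => exact ⟨0, D.zero_mem, by simp⟩
    | succ n ih =>
      obtain ⟨q, hqD, hq⟩ := ih
      refine ⟨q + (c : ℂ) • u ^ n, add_mem hqD (SMulMemClass.smul_mem _ (pow_mem huD n)), ?_⟩
      rw [mul_add, ← hq, mul_smul_comm, (hcomm.pow_right n).eq, pow_succ]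
      nth_rw 2 [hu]
      rw [mul_sub, mul_one, mul_smul_comm]
      abel
  choose q hqD hq using hq
  refine mem_closure_of_tendsto (f := fun n : ℕ => w * p * q n) (b := Filter.atTop) ?_
    (Filter.Eventually.of_forall fun n => ⟨q n, hqD n, rfl⟩)
  have hlim : Filter.Tendsto (fun n : ℕ => w * u ^ n) Filter.atTop (nhds 0) := by
    rw [tendsto_zero_iff_norm_tendsto_zero]
    have h1 : Filter.Tendsto (fun n : ℕ => Real.sqrt ((‖p‖ + 1) / n)) Filter.atTop (nhds 0) := by
      simpa using (tendsto_const_div_atTop_nhds_zero_nat (‖p‖ + 1)).sqrt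
    refine squeeze_zero' (Filter.Eventually.of_forall fun n => norm_nonneg _) ?_ h1
    filter_upwards [Filter.eventually_gt_atTop 0] with n hn
    refine Real.le_sqrt_of_sq_le ?_
    rw [le_div_iff₀ (by exact_mod_cast hn), mul_comm]
    exact norm_mul_one_sub_pow_sq_le w n
  have : (fun n : ℕ => w * p * q n) = fun n : ℕ => w - w * u ^ n := by
    funext n
    rw [mul_assoc, ← hq, mul_sub, mul_one]
  rw [this]
  simpa using hlim.const_sub w

section Compatible

variable {D : StarSubalgebra ℂ A} {D₁ : StarSubalgebra ℂ B} {α : A →⋆ₐ[ℂ] B}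

/-- The elements of `D₁` which multiply an essential subset of `α(D)` into the range of `α`. -/
def compatible (hD : IsAbelian D) (hD₁ : IsAbelian D₁) (hα : ∀ d ∈ D, α d ∈ D₁) :
    StarSubalgebra ℂ B where
  carrier := {s | s ∈ D₁ ∧ ∀ e ∈ D, (∀ d ∈ D, (∃ c, s * α d = α c) → e * d = 0) → e = 0}
  mul_mem' := by
    rintro s t ⟨hs, hs'⟩ ⟨ht, ht'⟩
    refine ⟨mul_mem hs ht, fun e he h => hs' e he fun i hi hsi => ?_⟩
    obtain ⟨a, ha⟩ := hsi
    refine ht' _ (mul_mem he hi) fun j hj htj => ?_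
    obtain ⟨b, hb⟩ := htj
    rw [mul_assoc]
    refine h _ (mul_mem hi hj) ⟨a * b, ?_⟩
    rw [map_mul, map_mul, ← ha, ← hb, mul_assoc, ← mul_assoc t, hD₁ t ht _ (hα i hi)]
    simp only [mul_assoc]
  one_mem' := ⟨D₁.one_mem, fun e _ h => by
    simpa using h 1 D.one_mem ⟨1, by simp⟩⟩
  add_mem' := by
    rintro s t ⟨hs, hs'⟩ ⟨ht, ht'⟩
    refine ⟨add_mem hs ht, fun e he h => hs' e he fun i hi hsi => ?_⟩
    obtain ⟨a, ha⟩ := hsi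
    refine ht' _ (mul_mem he hi) fun j hj htj => ?_
    obtain ⟨b, hb⟩ := htj
    rw [mul_assoc]
    refine h _ (mul_mem hi hj) ⟨a * j + b * i, ?_⟩
    rw [add_mul, map_add, map_mul α a, map_mul α b, ← ha, ← hb, mul_assoc, mul_assoc, ← map_mul,
      ← map_mul, hD j hj i hi]
  zero_mem' := ⟨D₁.zero_mem, fun e _ h => by
    simpa using h 1 D.one_mem ⟨0, by simp⟩⟩
  algebraMap_mem' := fun r => ⟨D₁.algebraMap_mem r, fun e _ h => by
    simpa using h 1 D.one_mem ⟨algebraMap ℂ A r, by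
      rw [map_one, mul_one]; exact (AlgHomClass.commutes α r).symm⟩⟩
  star_mem' := by
    rintro s ⟨hs, hs'⟩
    refine ⟨star_mem hs, fun e he h => hs' e he fun d hd hsd => ?_⟩
    obtain ⟨c, hc⟩ := hsd
    have h1 : e * star d = 0 := h _ (star_mem hd) ⟨star c, by
      rw [map_star, map_star, ← star_mul, ← hD₁ s hs _ (hα d hd), hc]⟩
    have h2 := hD.star_mul_eq_zero (star_mem hd) ((hD _ (star_mem hd) e he).trans h1)
    rwa [star_star, hD d hd e he] at h2

lemma map_mem_compatible (hD : IsAbelian D) (hD₁ : IsAbelian D₁) (hα : ∀ d ∈ D, α d ∈ D₁) {d : A}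
    (hd : d ∈ D) : α d ∈ compatible hD hD₁ hα :=
  ⟨hα d hd, fun e _ h => by simpa using h 1 D.one_mem ⟨d, by simp⟩⟩

lemma mul_mem_normSet {v w : A} (hv : v ∈ normSet D) (hw : w ∈ normSet D) : v * w ∈ normSet D := by
  refine ⟨fun d hd => ?_, fun d hd => ?_⟩
  · have := hw.1 _ (hv.1 d hd)
    simpa only [star_mul, mul_assoc] using this
  · have := hv.2 _ (hw.2 d hd)
    simpa only [star_mul, mul_assoc] using this

lemma star_mem_normSet {v : A} (hv : v ∈ normSet D) : star v ∈ normSet D :=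
  ⟨fun d hd => by simpa using hv.2 d hd, fun d hd => by simpa using hv.1 d hd⟩

lemma mem_normSet_of_mem {v : A} (hv : v ∈ D) : v ∈ normSet D :=
  ⟨fun _ hd => mul_mem (mul_mem (star_mem hv) hd) hv,
    fun _ hd => mul_mem (mul_mem hv hd) (star_mem hv)⟩

lemma star_mul_mul_mem_compatible {hD : IsAbelian D} {hD₁ : IsAbelian D₁}
    {hα : ∀ d ∈ D, α d ∈ D₁} {v : A} (hv : v ∈ normSet D) (hv' : α v ∈ normSet D₁) {s : B}
    (hs : s ∈ compatible hD hD₁ hα) : star (α v) * s * α v ∈ compatible hD hD₁ hα := by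
  obtain ⟨hs, hs'⟩ := hs
  refine ⟨hv'.1 s hs, fun e he h => ?_⟩
  have hp := normSet.star_mul_self_mem hv
  have hq := normSet.mul_star_self_mem hv
  have h1 : v * e * star v * (v * star v * (v * star v)) = 0 := by
    refine hs' _ (mul_mem (hv.2 e he) (mul_mem hq hq)) fun i hi hsi => ?_
    obtain ⟨c, hc⟩ := hsi
    have h2 := h (star v * v * (star v * i * v)) (mul_mem hp (hv.1 i hi))
      ⟨star v * c * (v * star v * (v * star v)) * v, by
        calc _ = star (α v) * s * α (v * star v * (v * star v) * i) * α v := by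
              simp only [map_mul, map_star, mul_assoc]
          _ = star (α v) * (s * α i) * α (v * star v * (v * star v)) * α v := by
              rw [hD _ (mul_mem hq hq) i hi, map_mul]; simp only [mul_assoc]
          _ = _ := by rw [hc]; simp only [map_mul, map_star, mul_assoc]⟩
    calc _ = v * e * star v * (v * star v) * (i * (v * star v)) := by
          rw [hD i hi _ hq]; simp only [mul_assoc]
      _ = v * (e * (star v * v * (star v * i * v))) * star v := by simp only [mul_assoc]
      _ = 0 := by rw [h2, mul_zero, zero_mul]
  have hsq : ∀ x : A, star x * x = 0 → x = 0 := fun x => CStarRing.star_mul_self_eq_zero_iff x |>.1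
  have h2 : star v * v * (star v * v * (e * (star v * v * (star v * v)))) = 0 := by
    calc _ = star v * v * (e * (star v * v) * (star v * v * (star v * v))) := by
          rw [← mul_assoc (star v * v) e, hD _ hp e he]
      _ = star v * (v * e * star v * (v * star v * (v * star v))) * v := by simp only [mul_assoc]
      _ = 0 := by rw [h1, mul_zero, zero_mul]
  rw [hD e he _ (mul_mem hp hp)] at h2
  have h3 : star v * v * (star v * v * e) = 0 := by
    refine hsq _ ?_
    simp only [star_mul, star_star, mul_assoc] at h2 ⊢
    rw [h2, mul_zero]
  have h4 : star v * v * e = 0 := by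
    refine hsq _ ?_
    simp only [star_mul, star_star, mul_assoc] at h3 ⊢
    rw [h3, mul_zero]
  have h5 : v * e = 0 := by
    refine hsq _ ?_
    simp only [star_mul, mul_assoc] at h4 ⊢
    rw [h4, mul_zero]
  have h6 := h e he ⟨0, by rw [mul_assoc, ← map_mul, h5, map_zero, mul_zero]⟩
  exact hsq e (hD.star_mul_eq_zero he h6)

lemma compatible_le {hD : IsAbelian D} {hD₁ : IsAbelian D₁} {hα : ∀ d ∈ D, α d ∈ D₁}
    (hcl : IsClosed (D₁ : Set B)) : (compatible hD hD₁ hα).topologicalClosure ≤ D₁ :=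
  StarSubalgebra.topologicalClosure_minimal (fun _ hx => hx.1) hcl

lemma star_mul_mul_mem_closure_compatible {hD : IsAbelian D} {hD₁ : IsAbelian D₁}
    {hα : ∀ d ∈ D, α d ∈ D₁} {v : A} (hv : v ∈ normSet D) (hv' : α v ∈ normSet D₁) {s : B}
    (hs : s ∈ (compatible hD hD₁ hα).topologicalClosure) :
    star (α v) * s * α v ∈ (compatible hD hD₁ hα).topologicalClosure :=
  map_mem_closure (f := fun x => star (α v) * x * α v) (by fun_prop) hs
    fun _ hx => star_mul_mul_mem_compatible hv hv' hx

lemma mul_map_mem_closure {hD : IsAbelian D} {hD₁ : IsInclusion D₁} {hα : ∀ d ∈ D, α d ∈ D₁}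
    (hαc : Continuous α) {v : A} (hv : v ∈ normSet D) (hv' : α v ∈ normSet D₁) {s : B}
    (hs : s ∈ (compatible hD hD₁.1 hα).topologicalClosure) :
    s * α v ∈ closure {x | ∃ t ∈ (compatible hD hD₁.1 hα).topologicalClosure, x = α v * t} := by
  refine map_mem_closure (f := fun x => s * α x) (by fun_prop)
    (mem_closure_mul_star_mul_self (normSet.star_mul_self_mem hv)) ?_
  rintro _ ⟨d, hd, rfl⟩
  refine ⟨star (α v) * s * α v * α d, mul_mem (star_mul_mul_mem_closure_compatible hv hv' hs)
    (StarSubalgebra.le_topologicalClosure _ (map_mem_compatible hD hD₁.1 hα hd)), ?_⟩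
  have h1 := hD₁.1 _ (compatible_le hD₁.2 hs) _ (normSet.mul_star_self_mem hv')
  calc _ = s * (α v * star (α v)) * (α v * α d) := by simp only [map_mul, map_star, mul_assoc]
    _ = _ := by rw [h1]; simp only [mul_assoc]

/-- The closed span of a set which is closed under products and adjoints up to the closed span. -/
noncomputable def closedSpan (G : Set B) (h1 : 1 ∈ G)
    (hmul : ∀ x ∈ G, ∀ y ∈ G, x * y ∈ (Submodule.span ℂ G).topologicalClosure)
    (hstar : ∀ x ∈ G, star x ∈ (Submodule.span ℂ G).topologicalClosure) : StarSubalgebra ℂ B :=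
  let M := (Submodule.span ℂ G).topologicalClosure
  have hM : IsClosed (M : Set B) := Submodule.isClosed_topologicalClosure _
  have hmin : ∀ N : Submodule ℂ B, IsClosed (N : Set B) → G ⊆ N → M ≤ N := fun _ hN h =>
    Submodule.topologicalClosure_minimal _ (Submodule.span_le.2 h) hN
  have h1M : (1 : B) ∈ M := Submodule.le_topologicalClosure _ (Submodule.subset_span h1)
  have hmul' : ∀ x ∈ M, ∀ y ∈ M, x * y ∈ M := fun x hx y hy =>
    hmin (M.comap (LinearMap.mulRight ℂ y)) (hM.preimage (continuous_mul_const y))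
      (fun z hz => hmin (M.comap (LinearMap.mulLeft ℂ z)) (hM.preimage (continuous_const_mul z))
        (fun t ht => hmul z hz t ht) hy) hx
  { carrier := M
    mul_mem' := fun hx hy => hmul' _ hx _ hy
    one_mem' := h1M
    add_mem' := M.add_mem
    zero_mem' := M.zero_mem
    algebraMap_mem' := fun r => by
      rw [Algebra.algebraMap_eq_smul_one]; exact M.smul_mem r h1M
    star_mem' := fun hx =>
      hmin (M.comap (starLinearEquiv ℂ (A := B)).toLinearMap) (hM.preimage continuous_star)
        hstar hx }

/-- The products of images of normalizers with limits of compatible elements. -/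
def compatibleGen (hD : IsAbelian D) (hD₁ : IsAbelian D₁) (hα : ∀ d ∈ D, α d ∈ D₁) : Set B :=
  {x | ∃ v ∈ normSet D, ∃ s ∈ (compatible hD hD₁ hα).topologicalClosure, x = α v * s}

/-- The closed span of products of images of normalizers with compatible elements. -/
noncomputable def compatibleSpan (hD : IsAbelian D) (hD₁ : IsInclusion D₁) (hα : ∀ d ∈ D, α d ∈ D₁)
    (hαc : Continuous α) (hN : ∀ v ∈ normSet D, α v ∈ normSet D₁) : StarSubalgebra ℂ B :=
  have key : ∀ v ∈ normSet D, ∀ w ∈ normSet D, ∀ s ∈ (compatible hD hD₁.1 hα).topologicalClosure,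
      ∀ t ∈ (compatible hD hD₁.1 hα).topologicalClosure, α v * (s * α w) * t ∈
        (Submodule.span ℂ (compatibleGen hD hD₁.1 hα)).topologicalClosure :=
    fun v hv w hw s hs t ht => by
      refine map_mem_closure (f := fun x => α v * x * t) (by fun_prop)
        (mul_map_mem_closure (hD₁ := hD₁) hαc hw (hN w hw) hs) ?_
      rintro _ ⟨r, hr, rfl⟩
      refine Submodule.subset_span ⟨v * w, mul_mem_normSet hv hw, r * t, mul_mem hr ht, ?_⟩
      simp only [map_mul, mul_assoc]
  closedSpan (compatibleGen hD hD₁.1 hα)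
    ⟨1, mem_normSet_of_mem D.one_mem, 1, one_mem _, by simp⟩
    (by
      rintro _ ⟨v, hv, s, hs, rfl⟩ _ ⟨w, hw, t, ht, rfl⟩
      simpa only [mul_assoc] using key v hv w hw s hs t ht)
    (by
      rintro _ ⟨v, hv, s, hs, rfl⟩
      simpa [map_star] using key 1 (mem_normSet_of_mem D.one_mem) (star v)
        (star_mem_normSet hv) (star s) (star_mem hs) 1 (one_mem _))

section

variable {hD : IsAbelian D} {hD₁ : IsInclusion D₁} {hα : ∀ d ∈ D, α d ∈ D₁} {hαc : Continuous α}
  {hN : ∀ v ∈ normSet D, α v ∈ normSet D₁}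

lemma isClosed_compatibleSpan : IsClosed (compatibleSpan hD hD₁ hα hαc hN : Set B) :=
  Submodule.isClosed_topologicalClosure _

lemma mem_of_mem_compatibleSpan {N : Submodule ℂ B} (hNc : IsClosed (N : Set B))
    (h : ∀ v ∈ normSet D, ∀ s ∈ (compatible hD hD₁.1 hα).topologicalClosure, α v * s ∈ N) {t : B}
    (ht : t ∈ compatibleSpan hD hD₁ hα hαc hN) : t ∈ N := by
  refine Submodule.topologicalClosure_minimal _ (Submodule.span_le.2 ?_) hNc ht
  rintro _ ⟨v, hv, s, hs, rfl⟩
  exact h v hv s hs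

lemma mul_mem_compatibleSpan {v : A} (hv : v ∈ normSet D) {s : B}
    (hs : s ∈ (compatible hD hD₁.1 hα).topologicalClosure) :
    α v * s ∈ compatibleSpan hD hD₁ hα hαc hN :=
  Submodule.le_topologicalClosure _ (Submodule.subset_span ⟨v, hv, s, hs, rfl⟩)

lemma closure_compatible_le :
    (compatible hD hD₁.1 hα).topologicalClosure ≤ compatibleSpan hD hD₁ hα hαc hN := fun s hs => by
  simpa using mul_mem_compatibleSpan (hαc := hαc) (hN := hN) (mem_normSet_of_mem D.one_mem) hs

lemma map_mem_compatibleSpan (hreg : IsRegularIncl D) (x : A) :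
    α x ∈ compatibleSpan hD hD₁ hα hαc hN := by
  refine hreg.induction (N := (compatibleSpan hD hD₁ hα hαc hN).toSubalgebra.toSubmodule.comap
    (α : A →ₗ[ℂ] B))
    (IsClosed.preimage hαc (isClosed_compatibleSpan (hD₁ := hD₁) (hαc := hαc) (hN := hN)))
    (fun v hv => ?_) x
  simpa using mul_mem_compatibleSpan (hαc := hαc) (hN := hN) hv
    (one_mem (compatible hD hD₁.1 hα).topologicalClosure)

end

end Compatible

lemma IsCartanEnvelope.condExp_mul_eq [PartialOrder B] [StarOrderedRing B] {D : StarSubalgebra ℂ A}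
    {D₁ : StarSubalgebra ℂ B} {α : A →⋆ₐ[ℂ] B} {E : B →ₗ[ℂ] B} (h : IsCartanEnvelope D D₁ α E)
    {v d : A} (hv : v ∈ normSet D) (hd : d ∈ D) (hvd : ∀ k ∈ D, v * d * k = k * (v * d)) :
    E (α v) * α d = α (v * d) := by
  obtain ⟨⟨hreg, -, hα, hE, -⟩, hmasa, hess⟩ := h
  have hw : α (v * d) ∈ D₁ := hmasa.2 _ fun k hk =>
    hess.commute_of_commute hreg.1 (hα.2 _ (mul_mem_normSet hv (mem_normSet_of_mem hd)))
      (fun c hc => by rw [← map_mul, hvd c hc, map_mul]) hk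
  have h1 := hE.bimod 1 D₁.one_mem _ (hα.1 d hd) (α v)
  simp only [one_mul] at h1
  rw [← h1, ← map_mul, hE.idOn _ hw]

section Two

variable {B₁ : Type*} [NormedRing B₁] [StarRing B₁] [CStarRing B₁] [CompleteSpace B₁]
  [NormedAlgebra ℂ B₁] [StarModule ℂ B₁] [PartialOrder B₁] [StarOrderedRing B₁]
variable {B₂ : Type*} [NormedRing B₂] [StarRing B₂] [CStarRing B₂] [CompleteSpace B₂]
  [NormedAlgebra ℂ B₂] [StarModule ℂ B₂] [PartialOrder B₂] [StarOrderedRing B₂]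
variable {D : StarSubalgebra ℂ A} {D₁ : StarSubalgebra ℂ B₁} {α₁ : A →⋆ₐ[ℂ] B₁} {E₁ : B₁ →ₗ[ℂ] B₁}
  {D₂ : StarSubalgebra ℂ B₂} {α₂ : A →⋆ₐ[ℂ] B₂} {E₂ : B₂ →ₗ[ℂ] B₂}

/-- The product of two star subalgebras. -/
def prodSub (D₁ : StarSubalgebra ℂ B₁) (D₂ : StarSubalgebra ℂ B₂) : StarSubalgebra ℂ (B₁ × B₂) :=
  D₁.comap (StarAlgHom.fst ℂ B₁ B₂) ⊓ D₂.comap (StarAlgHom.snd ℂ B₁ B₂)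

lemma IsInclusion.prodSub (h₁ : IsInclusion D₁) (h₂ : IsInclusion D₂) :
    IsInclusion (prodSub D₁ D₂) :=
  ⟨fun _ hx _ hy => Prod.ext (h₁.1 _ hx.1 _ hy.1) (h₂.1 _ hx.2 _ hy.2), h₁.2.prod h₂.2⟩

lemma prod_mem_prodSub (h₁ : ∀ d ∈ D, α₁ d ∈ D₁) (h₂ : ∀ d ∈ D, α₂ d ∈ D₂) :
    ∀ d ∈ D, α₁.prod α₂ d ∈ prodSub D₁ D₂ :=
  fun d hd => ⟨h₁ d hd, h₂ d hd⟩

lemma prod_mem_normSet (h₁ : ∀ v ∈ normSet D, α₁ v ∈ normSet D₁)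
    (h₂ : ∀ v ∈ normSet D, α₂ v ∈ normSet D₂) :
    ∀ v ∈ normSet D, α₁.prod α₂ v ∈ normSet (prodSub D₁ D₂) :=
  fun v hv => ⟨fun _ hd => ⟨(h₁ v hv).1 _ hd.1, (h₂ v hv).1 _ hd.2⟩,
    fun _ hd => ⟨(h₁ v hv).2 _ hd.1, (h₂ v hv).2 _ hd.2⟩⟩

/-- The pairs of compatible elements for two extensions of `(A, D)`. -/
noncomputable def compatiblePair (hD : IsAbelian D) (h₁ : IsCartanEnvelope D D₁ α₁ E₁)
    (h₂ : IsCartanEnvelope D D₂ α₂ E₂) : StarSubalgebra ℂ (B₁ × B₂) :=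
  compatible hD (h₁.1.1.1.prodSub h₂.1.1.1).1 (prod_mem_prodSub h₁.1.2.2.1.1 h₂.1.2.2.1.1)

lemma condExp_mem_compatiblePair (hD : IsAbelian D) (h₁ : IsCartanEnvelope D D₁ α₁ E₁)
    (h₂ : IsCartanEnvelope D D₂ α₂ E₂) {v : A} (hv : v ∈ normSet D) :
    (E₁ (α₁ v), E₂ (α₂ v)) ∈ compatiblePair hD h₁ h₂ := by
  have hE₁ := h₁.1.2.2.2.1
  have hE₂ := h₂.1.2.2.2.1
  refine ⟨⟨hE₁.mem _, hE₂.mem _⟩, fun e he h => ?_⟩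
  have hJ : ∀ d ∈ D, (∀ k ∈ D, v * d * k = k * (v * d)) → e * d = 0 := fun d hd hvd =>
    h d hd ⟨v * d, Prod.ext (h₁.condExp_mul_eq hv hd hvd) (h₂.condExp_mul_eq hv hd hvd)⟩
  have h0 := h e he ⟨0, by
    rw [map_zero]
    exact Prod.ext
      (h₁.2.2.condExp_mul_eq_zero hD h₁.1.1.1 h₁.1.2.1 h₁.1.2.2.1.1 hE₁ (h₁.1.2.2.1.2 v hv) he hJ)
      (h₂.2.2.condExp_mul_eq_zero hD h₂.1.1.1 h₂.1.2.1 h₂.1.2.2.1.1 hE₂ (h₂.1.2.2.1.2 v hv) he hJ)⟩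
  exact CStarRing.star_mul_self_eq_zero_iff e |>.1 (hD.star_mul_eq_zero he h0)

lemma condExp_mem_closure_compatiblePair (hreg : IsRegularIncl D)
    (h₁ : IsCartanEnvelope D D₁ α₁ E₁) (h₂ : IsCartanEnvelope D D₂ α₂ E₂) (x : A) :
    (E₁ (α₁ x), E₂ (α₂ x)) ∈ (compatiblePair hreg.1.1 h₁ h₂).topologicalClosure := by
  have c₁ := continuous_starAlgHom_of_injective h₁.1.2.1
  have c₂ := continuous_starAlgHom_of_injective h₂.1.2.1
  have d₁ := h₁.1.2.2.2.1.continuous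
  have d₂ := h₂.1.2.2.2.1.continuous
  refine hreg.induction
    (N := (compatiblePair hreg.1.1 h₁ h₂).topologicalClosure.toSubalgebra.toSubmodule.comap
      ((E₁ ∘ₗ (α₁ : A →ₗ[ℂ] B₁)).prod (E₂ ∘ₗ (α₂ : A →ₗ[ℂ] B₂))))
    ((StarSubalgebra.isClosed_topologicalClosure _).preimage
      (f := fun x => (E₁ (α₁ x), E₂ (α₂ x))) (by fun_prop)) (fun v hv => ?_) x
  exact StarSubalgebra.le_topologicalClosure _ (condExp_mem_compatiblePair hreg.1.1 h₁ h₂ hv)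

lemma norm_fst_eq_norm_snd (hD : IsAbelian D) (h₁ : IsCartanEnvelope D D₁ α₁ E₁)
    (h₂ : IsCartanEnvelope D D₂ α₂ E₂) {s : B₁ × B₂}
    (hs : s ∈ (compatiblePair hD h₁ h₂).topologicalClosure) : ‖s.1‖ = ‖s.2‖ := by
  refine closure_minimal (t := {s : B₁ × B₂ | ‖s.1‖ = ‖s.2‖}) (fun s hs => ?_)
    (isClosed_eq (by fun_prop) (by fun_prop)) hs
  obtain ⟨hsD, hs⟩ := hs
  refine le_antisymm
    (h₁.2.2.norm_le hD h₁.1.1.1 h₁.1.2.1 h₁.1.2.2.1.1 h₂.1.2.1 hsD.1 fun e he h => ?_)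
    (h₂.2.2.norm_le hD h₂.1.1.1 h₂.1.2.1 h₂.1.2.2.1.1 h₁.1.2.1 hsD.2 fun e he h => ?_)
  · exact hs e he fun d hd ⟨c, hc⟩ => h d hd ⟨c, congrArg Prod.fst hc, congrArg Prod.snd hc⟩
  · exact hs e he fun d hd ⟨c, hc⟩ => h d hd ⟨c, congrArg Prod.snd hc, congrArg Prod.fst hc⟩
/-- The closed span of products of images of normalizers with compatible elements, for two
extensions of `(A, D)`. -/
noncomputable def envelopePair (hD : IsAbelian D) (h₁ : IsCartanEnvelope D D₁ α₁ E₁)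
    (h₂ : IsCartanEnvelope D D₂ α₂ E₂) : StarSubalgebra ℂ (B₁ × B₂) :=
  compatibleSpan hD (h₁.1.1.1.prodSub h₂.1.1.1) (prod_mem_prodSub h₁.1.2.2.1.1 h₂.1.2.2.1.1)
    (α := α₁.prod α₂) ((continuous_starAlgHom_of_injective h₁.1.2.1).prodMk
      (continuous_starAlgHom_of_injective h₂.1.2.1))
    (prod_mem_normSet h₁.1.2.2.1.2 h₂.1.2.2.1.2)

lemma condExp_mem_of_mem_envelopePair (hreg : IsRegularIncl D) (h₁ : IsCartanEnvelope D D₁ α₁ E₁)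
    (h₂ : IsCartanEnvelope D D₂ α₂ E₂) {t : B₁ × B₂} (ht : t ∈ envelopePair hreg.1.1 h₁ h₂) :
    (E₁ t.1, E₂ t.2) ∈ (compatiblePair hreg.1.1 h₁ h₂).topologicalClosure := by
  have hE₁ := h₁.1.2.2.2.1
  have hE₂ := h₂.1.2.2.2.1
  have d₁ := hE₁.continuous
  have d₂ := hE₂.continuous
  refine mem_of_mem_compatibleSpan
    (N := (compatiblePair hreg.1.1 h₁ h₂).topologicalClosure.toSubalgebra.toSubmodule.comap
      (E₁.prodMap E₂))
    ((StarSubalgebra.isClosed_topologicalClosure _).preimage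
      (f := fun x : B₁ × B₂ => (E₁ x.1, E₂ x.2)) (by fun_prop)) (fun v hv s hs => ?_) ht
  have hsD : s.1 ∈ D₁ ∧ s.2 ∈ D₂ := compatible_le (h₁.1.1.1.prodSub h₂.1.1.1).2 hs
  have e₁ := hE₁.bimod 1 D₁.one_mem _ hsD.1 (α₁ v)
  have e₂ := hE₂.bimod 1 D₂.one_mem _ hsD.2 (α₂ v)
  simp only [one_mul] at e₁ e₂
  have := mul_mem (condExp_mem_closure_compatiblePair hreg h₁ h₂ v) hs
  rw [Prod.mk_mul_mk, ← e₁, ← e₂] at this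
  exact this

lemma eq_zero_of_mem_envelopePair (hreg : IsRegularIncl D) (h₁ : IsCartanEnvelope D D₁ α₁ E₁)
    (h₂ : IsCartanEnvelope D D₂ α₂ E₂) {t : B₁ × B₂} (ht : t ∈ envelopePair hreg.1.1 h₁ h₂)
    (h : t.1 = 0 ∨ t.2 = 0) : t = 0 := by
  have hn := norm_fst_eq_norm_snd hreg.1.1 h₁ h₂
    (condExp_mem_of_mem_envelopePair hreg h₁ h₂ (mul_mem (star_mem ht) ht))
  simp only [Prod.fst_mul, Prod.snd_mul, Prod.fst_star, Prod.snd_star] at hn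
  rcases h with h | h
  · rw [h, mul_zero, map_zero, norm_zero] at hn
    exact Prod.ext h (h₂.1.2.2.2.2.1 _ (norm_eq_zero.1 hn.symm))
  · rw [h, mul_zero, map_zero, norm_zero] at hn
    exact Prod.ext (h₁.1.2.2.2.2.1 _ (norm_eq_zero.1 hn)) h

lemma map_mem_envelopePair (hreg : IsRegularIncl D) (h₁ : IsCartanEnvelope D D₁ α₁ E₁)
    (h₂ : IsCartanEnvelope D D₂ α₂ E₂) (x : A) :
    (α₁ x, α₂ x) ∈ envelopePair hreg.1.1 h₁ h₂ :=
  map_mem_compatibleSpan hreg x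

lemma condExp_map_mem_envelopePair (hreg : IsRegularIncl D) (h₁ : IsCartanEnvelope D D₁ α₁ E₁)
    (h₂ : IsCartanEnvelope D D₂ α₂ E₂) (x : A) :
    (E₁ (α₁ x), E₂ (α₂ x)) ∈ envelopePair hreg.1.1 h₁ h₂ :=
  closure_compatible_le (condExp_mem_closure_compatiblePair hreg h₁ h₂ x)

lemma apply_fst_eq_snd {hD : IsAbelian D} (h₁ : IsCartanEnvelope D D₁ α₁ E₁)
    (h₂ : IsCartanEnvelope D D₂ α₂ E₂) {ψ : B₁ →⋆ₐ[ℂ] B₂} (hc : Continuous ψ)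
    (hψ : ∀ d ∈ D₁, ψ d ∈ D₂) (hα : ∀ x, ψ (α₁ x) = α₂ x) {s : B₁ × B₂}
    (hs : s ∈ (compatiblePair hD h₁ h₂).topologicalClosure) : ψ s.1 = s.2 := by
  refine closure_minimal (t := {s : B₁ × B₂ | ψ s.1 = s.2}) (fun s hs => ?_)
    (isClosed_eq (by fun_prop) (by fun_prop)) hs
  obtain ⟨hsD, hs⟩ := hs
  refine sub_eq_zero.1 (h₂.2.2.eq_zero_of_mul_eq_zero h₂.1.1.1 h₂.1.2.1 h₂.1.2.2.1.1
    (sub_mem (hψ _ hsD.1) hsD.2) fun e he h => hs e he fun d hd ⟨c, hc⟩ => h d hd ?_)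
  have e₁ : s.1 * α₁ d = α₁ c := congrArg Prod.fst hc
  have e₂ : s.2 * α₂ d = α₂ c := congrArg Prod.snd hc
  rw [sub_mul, e₂, ← hα d, ← map_mul, e₁, hα, sub_self]

end Two

lemma IsPackage.eq_top {B : Type*} [NormedRing B] [StarRing B] [CStarRing B] [CompleteSpace B]
    [NormedAlgebra ℂ B] [StarModule ℂ B] [PartialOrder B] [StarOrderedRing B]
    {D : StarSubalgebra ℂ A} {D₁ : StarSubalgebra ℂ B} {α : A →⋆ₐ[ℂ] B} {E : B →ₗ[ℂ] B}
    (h : IsPackage D D₁ α E) {S : StarSubalgebra ℂ B} (hS : IsClosed (S : Set B))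
    (hα : ∀ x, α x ∈ S) (hE : ∀ x, E (α x) ∈ S) : S = ⊤ := by
  refine top_le_iff.1 (h.2.2.2.2.2.1.ge.trans (StarSubalgebra.topologicalClosure_minimal ?_ hS))
  refine StarAlgebra.adjoin_le ?_
  rintro _ (⟨x, rfl⟩ | ⟨_, ⟨x, rfl⟩, rfl⟩)
  exacts [hα x, hE x]

lemma IsPackage.le {B : Type*} [NormedRing B] [StarRing B] [CStarRing B] [CompleteSpace B]
    [NormedAlgebra ℂ B] [StarModule ℂ B] [PartialOrder B] [StarOrderedRing B]
    {D : StarSubalgebra ℂ A} {D₁ : StarSubalgebra ℂ B} {α : A →⋆ₐ[ℂ] B} {E : B →ₗ[ℂ] B}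
    (h : IsPackage D D₁ α E) {S : StarSubalgebra ℂ B} (hS : IsClosed (S : Set B))
    (hE : ∀ x, E (α x) ∈ S) : D₁ ≤ S := by
  refine h.2.2.2.2.2.2.ge.trans (StarSubalgebra.topologicalClosure_minimal ?_ hS)
  refine StarAlgebra.adjoin_le ?_
  rintro _ ⟨_, ⟨x, rfl⟩, rfl⟩
  exact hE x

/-- A package is covered by any `C*`-subalgebra whose image contains the generators. -/
lemma IsPackage.bijective {B C : Type*} [NormedRing B] [StarRing B] [CStarRing B] [CompleteSpace B]
    [NormedAlgebra ℂ B] [StarModule ℂ B] [PartialOrder B] [StarOrderedRing B]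
    [NormedRing C] [StarRing C] [CStarRing C] [CompleteSpace C] [NormedAlgebra ℂ C] [StarModule ℂ C]
    {D : StarSubalgebra ℂ A} {D₁ : StarSubalgebra ℂ B} {α : A →⋆ₐ[ℂ] B} {E : B →ₗ[ℂ] B}
    (h : IsPackage D D₁ α E) {T : StarSubalgebra ℂ C} (hT : IsClosed (T : Set C))
    {f : C →⋆ₐ[ℂ] B} (hf : ∀ t ∈ T, f t = 0 → t = 0) (hα : ∀ x, ∃ t ∈ T, f t = α x)
    (hE : ∀ x, ∃ t ∈ T, f t = E (α x)) : Function.Bijective (f.comp T.subtype) := by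
  have : CompleteSpace T := hT.completeSpace_coe
  have hinj : Function.Injective (f.comp T.subtype) :=
    (injective_iff_map_eq_zero _).2 fun t ht => Subtype.ext (hf t t.2 ht)
  have hiso : Isometry (f.comp T.subtype) :=
    AddMonoidHomClass.isometry_of_norm _ (norm_map_of_injective hinj)
  refine ⟨hinj, fun b => (h.eq_top (S := (f.comp T.subtype).range) ?_ (fun x => ?_)
    fun x => ?_).ge (StarSubalgebra.mem_top (x := b))⟩
  · exact hiso.isClosedEmbedding.isClosed_range
  · obtain ⟨t, ht, hx⟩ := hα x
    exact ⟨⟨t, ht⟩, hx⟩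
  · obtain ⟨t, ht, hx⟩ := hE x
    exact ⟨⟨t, ht⟩, hx⟩

lemma normSet.map_mem {B C : Type*} [NormedRing B] [StarRing B] [CStarRing B]
    [CompleteSpace B] [NormedAlgebra ℂ B] [StarModule ℂ B] [NormedRing C] [StarRing C] [CStarRing C]
    [CompleteSpace C] [NormedAlgebra ℂ C] [StarModule ℂ C]
    {D₁ : StarSubalgebra ℂ B} {D₂ : StarSubalgebra ℂ C} {ψ : B →⋆ₐ[ℂ] C}
    (h : ∀ d ∈ D₁, ψ d ∈ D₂) (h' : ∀ d ∈ D₂, ∃ c ∈ D₁, ψ c = d) {v : B} (hv : v ∈ normSet D₁) :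
    ψ v ∈ normSet D₂ := by
  refine ⟨fun d hd => ?_, fun d hd => ?_⟩ <;> obtain ⟨c, hc, rfl⟩ := h' d hd
  · simpa [map_star] using h _ (hv.1 c hc)
  · simpa [map_star] using h _ (hv.2 c hc)

end RegularInclusion

namespace RegularInclusion

variable {A : Type*} [NormedRing A] [StarRing A] [CStarRing A] [CompleteSpace A]
  [NormedAlgebra ℂ A] [StarModule ℂ A]

variable {B₁ : Type*} [NormedRing B₁] [StarRing B₁] [CStarRing B₁] [CompleteSpace B₁]
  [NormedAlgebra ℂ B₁] [StarModule ℂ B₁] [PartialOrder B₁] [StarOrderedRing B₁]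
variable {B₂ : Type*} [NormedRing B₂] [StarRing B₂] [CStarRing B₂] [CompleteSpace B₂]
  [NormedAlgebra ℂ B₂] [StarModule ℂ B₂] [PartialOrder B₂] [StarOrderedRing B₂]

/-- Uniqueness of the Cartan envelope: given two Cartan envelopes
`(B₁,D₁,α₁)` and `(B₂,D₂,α₂)` of a regular inclusion `(A,D)`, there is a unique regular
`*`-isomorphism `ψ : B₁ → B₂` with `ψ ∘ α₁ = α₂`, and it intertwines the conditional
expectations: `ψ(α₁(v)·E₁(α₁(x))) = α₂(v)·E₂(α₂(x))`. -/
theorem stmt11 (D : StarSubalgebra ℂ A) (hreg : IsRegularIncl D)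
    (D₁ : StarSubalgebra ℂ B₁) (α₁ : A →⋆ₐ[ℂ] B₁) (E₁ : B₁ →ₗ[ℂ] B₁)
    (henv₁ : IsCartanEnvelope D D₁ α₁ E₁)
    (D₂ : StarSubalgebra ℂ B₂) (α₂ : A →⋆ₐ[ℂ] B₂) (E₂ : B₂ →ₗ[ℂ] B₂)
    (henv₂ : IsCartanEnvelope D D₂ α₂ E₂) :
    ∃ ψ : B₁ →⋆ₐ[ℂ] B₂,
      (Function.Bijective ψ ∧ IsRegularHom D₁ D₂ ψ ∧ ∀ x : A, ψ (α₁ x) = α₂ x) ∧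
      (∀ v ∈ normSet D, ∀ x : A, ψ (α₁ v * E₁ (α₁ x)) = α₂ v * E₂ (α₂ x)) ∧
      (∀ ψ' : B₁ →⋆ₐ[ℂ] B₂,
        (Function.Bijective ψ' ∧ IsRegularHom D₁ D₂ ψ' ∧ ∀ x : A, ψ' (α₁ x) = α₂ x) →
        ψ' = ψ) := by
  have hαeq := map_mem_envelopePair hreg henv₁ henv₂
  have hEeq := condExp_map_mem_envelopePair hreg henv₁ henv₂
  have hzero := fun t ht => eq_zero_of_mem_envelopePair hreg henv₁ henv₂ (t := t) ht
  have hcl : IsClosed (envelopePair hreg.1.1 henv₁ henv₂ : Set (B₁ × B₂)) :=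
    isClosed_compatibleSpan
  set T := envelopePair hreg.1.1 henv₁ henv₂
  have hb₁ : Function.Bijective ((StarAlgHom.fst ℂ B₁ B₂).comp T.subtype) :=
    henv₁.1.bijective hcl (fun t ht h => hzero t ht (Or.inl h)) (fun x => ⟨_, hαeq x, rfl⟩)
      fun x => ⟨_, hEeq x, rfl⟩
  have hb₂ : Function.Bijective ((StarAlgHom.snd ℂ B₁ B₂).comp T.subtype) :=
    henv₂.1.bijective hcl (fun t ht h => hzero t ht (Or.inr h)) (fun x => ⟨_, hαeq x, rfl⟩)
      fun x => ⟨_, hEeq x, rfl⟩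
  set φ := StarAlgEquiv.ofBijective _ hb₁
  set ψ : B₁ →⋆ₐ[ℂ] B₂ := ((StarAlgHom.snd ℂ B₁ B₂).comp T.subtype).comp (φ.symm : B₁ →⋆ₐ[ℂ] T)
  have hψ : ∀ t ∈ T, ψ t.1 = t.2 := fun t ht =>
    congrArg (fun s : T => (s : B₁ × B₂).2) (φ.symm_apply_apply ⟨t, ht⟩)
  have hbij : Function.Bijective ψ := hb₂.comp φ.symm.bijective
  have hψα : ∀ x, ψ (α₁ x) = α₂ x := fun x => hψ _ (hαeq x)
  have hψE : ∀ x, ψ (E₁ (α₁ x)) = E₂ (α₂ x) := fun x => hψ _ (hEeq x)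
  have hiso : Isometry ψ := AddMonoidHomClass.isometry_of_norm ψ (norm_map_of_injective hbij.1)
  have hD₁₂ : ∀ d ∈ D₁, ψ d ∈ D₂ := henv₁.1.le (S := D₂.comap ψ)
    (henv₂.1.1.1.2.preimage hiso.continuous) fun x => by
      rw [StarSubalgebra.mem_comap, hψE]; exact henv₂.1.2.2.2.1.mem _
  have hD₂₁ : ∀ d ∈ D₂, ∃ c ∈ D₁, ψ c = d := henv₂.1.le (S := D₁.map ψ)
    (hiso.isClosedEmbedding.isClosedMap _ henv₁.1.1.1.2) fun x =>
      ⟨E₁ (α₁ x), henv₁.1.2.2.2.1.mem _, hψE x⟩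
  refine ⟨ψ, ⟨hbij, ⟨hD₁₂, fun v hv => normSet.map_mem hD₁₂ hD₂₁ hv⟩, hψα⟩,
    fun v _ x => by rw [map_mul, hψα, hψE], fun ψ' ⟨hb', hr', hα'⟩ => ?_⟩
  have hc' := continuous_starAlgHom_of_injective hb'.1
  have hE' : ∀ x, ψ' (E₁ (α₁ x)) = E₂ (α₂ x) := fun x =>
    apply_fst_eq_snd henv₁ henv₂ hc' hr'.1 hα'
      (condExp_mem_closure_compatiblePair hreg henv₁ henv₂ x)
  have htop := henv₁.1.eq_top (S := StarAlgHom.equalizer ψ' ψ) (isClosed_eq hc' hiso.continuous)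
    (fun x => (hα' x).trans (hψα x).symm) fun x => (hE' x).trans (hψE x).symm
  exact StarAlgHom.ext fun b => htop.ge (StarSubalgebra.mem_top (x := b))

end RegularInclusion
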